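/- (Bregman mean identity and minimization.) Let Ω ⊆ ℝ^m be open and convex, φ : Ω → ℝ convex and differentiable, and U an integrable random vector with U ∈ Ω almost surely, ū := E[U] ∈ Ω, and with φ(U) and ⟨∇φ(v), U⟩ integrable for each v ∈ Ω. Then for every v ∈ Ω: E[D_φ(U, v)] = E[D_φ(U, ū)] + D_φ(ū, v). Consequently E[D_φ(U, v)] ≥ E[D_φ(U, ū)] for all v ∈ Ω, and if φ is strictly convex then v = ū is the unique minimizer of v ↦ E[D_φ(U, v)] over Ω. -/

import Mathlib

open MeasureTheory
open scoped RealInnerProductSpace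

/-- The Bregman divergence `D_φ(u, v) = φ(u) − φ(v) − ⟨∇φ(v), u − v⟩` generated by a
differentiable potential `φ`. -/
noncomputable def bregmanDiv {m : ℕ} (φ : EuclideanSpace ℝ (Fin m) → ℝ)
    (u v : EuclideanSpace ℝ (Fin m)) : ℝ :=
  φ u - φ v - ⟪gradient φ v, u - v⟫

theorem bregmanDiv_nonneg_aux {m : ℕ} (S : Set (EuclideanSpace ℝ (Fin m)))
    (φ : EuclideanSpace ℝ (Fin m) → ℝ) (hφconv : ConvexOn ℝ S φ)
    (u v : EuclideanSpace ℝ (Fin m)) (hu : u ∈ S) (hv : v ∈ S)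
    (hd : DifferentiableAt ℝ φ v) : 0 ≤ bregmanDiv φ u v := by
  have hc := hφconv.comp_affineMap (AffineMap.lineMap v u : ℝ →ᵃ[ℝ] EuclideanSpace ℝ (Fin m))
  have hg : HasFDerivAt φ (InnerProductSpace.toDual ℝ _ (gradient φ v))
      (AffineMap.lineMap v u (0 : ℝ)) := by
    rw [AffineMap.lineMap_apply_zero]
    exact hd.hasGradientAt.hasFDerivAt
  have hl : HasDerivAt (AffineMap.lineMap v u : ℝ → EuclideanSpace ℝ (Fin m)) (u - v) (0 : ℝ) :=
    AffineMap.hasDerivAt_lineMap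
  have hD := hg.comp_hasDerivAt (0 : ℝ) hl
  have h := hc.le_slope_of_hasDerivAt (x := 0) (y := 1) (by simpa using hv) (by simpa using hu)
    one_pos hD
  rw [InnerProductSpace.toDual_apply_apply, slope_def_field, Function.comp_apply,
    Function.comp_apply, AffineMap.lineMap_apply_zero, AffineMap.lineMap_apply_one, sub_zero,
    div_one] at h
  unfold bregmanDiv
  linarith

theorem integral_bregmanDiv_aux {m : ℕ} {Ω₀ : Type*} [MeasurableSpace Ω₀]
    (μ : Measure Ω₀) [IsProbabilityMeasure μ]
    (φ : EuclideanSpace ℝ (Fin m) → ℝ)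
    (U : Ω₀ → EuclideanSpace ℝ (Fin m)) (hUint : Integrable U μ)
    (hφU : Integrable (fun ω => φ (U ω)) μ) (v : EuclideanSpace ℝ (Fin m)) :
    ∫ ω, bregmanDiv φ (U ω) v ∂μ =
      (∫ ω, φ (U ω) ∂μ) - φ v - ⟪gradient φ v, (∫ ω, U ω ∂μ) - v⟫ := by
  have h1 : Integrable (fun ω => U ω - v) μ := hUint.sub (integrable_const v)
  have h2 : Integrable (fun ω => φ (U ω) - φ v) μ := hφU.sub (integrable_const _)
  unfold bregmanDiv
  rw [integral_sub h2 (h1.const_inner _), integral_sub hφU (integrable_const _),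
    integral_inner h1, integral_sub hUint (integrable_const _)]
  simp

/-- **Bregman mean identity and minimization.** For a convex differentiable potential `φ`
on an open convex set `S` and an integrable random vector `U` with values in `S` and mean
`ū = E[U] ∈ S`, one has `E[D_φ(U, v)] = E[D_φ(U, ū)] + D_φ(ū, v)` for every `v ∈ S`; hence
`ū` minimizes `v ↦ E[D_φ(U, v)]`, uniquely so when `φ` is strictly convex (in the sense
that `D_φ(u, v) > 0` whenever `u ≠ v`). -/
theorem bregman_mean_identity
    {m : ℕ} {Ω₀ : Type*} [MeasurableSpace Ω₀]
    (μ : Measure Ω₀) [IsProbabilityMeasure μ]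
    (S : Set (EuclideanSpace ℝ (Fin m))) (hopen : IsOpen S) (hconv : Convex ℝ S)
    (φ : EuclideanSpace ℝ (Fin m) → ℝ)
    (hφconv : ConvexOn ℝ S φ)
    (hφdiff : ∀ v ∈ S, DifferentiableAt ℝ φ v)
    (U : Ω₀ → EuclideanSpace ℝ (Fin m)) (hUint : Integrable U μ)
    (hUS : ∀ᵐ ω ∂μ, U ω ∈ S)
    (hmean : (∫ ω, U ω ∂μ) ∈ S)
    (hφU : Integrable (fun ω => φ (U ω)) μ)
    (hinner : ∀ v ∈ S, Integrable (fun ω => ⟪gradient φ v, U ω⟫) μ) :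
    (∀ v ∈ S, ∫ ω, bregmanDiv φ (U ω) v ∂μ =
        (∫ ω, bregmanDiv φ (U ω) (∫ ω', U ω' ∂μ) ∂μ) + bregmanDiv φ (∫ ω', U ω' ∂μ) v) ∧
    (∀ v ∈ S, (∫ ω, bregmanDiv φ (U ω) (∫ ω', U ω' ∂μ) ∂μ) ≤ ∫ ω, bregmanDiv φ (U ω) v ∂μ) ∧
    ((∀ u ∈ S, ∀ v ∈ S, u ≠ v → 0 < bregmanDiv φ u v) →
      ∀ v ∈ S, v ≠ (∫ ω', U ω' ∂μ) →
        (∫ ω, bregmanDiv φ (U ω) (∫ ω', U ω' ∂μ) ∂μ) < ∫ ω, bregmanDiv φ (U ω) v ∂μ) := by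
  have key : ∀ v ∈ S, ∫ ω, bregmanDiv φ (U ω) v ∂μ =
      (∫ ω, bregmanDiv φ (U ω) (∫ ω', U ω' ∂μ) ∂μ) + bregmanDiv φ (∫ ω', U ω' ∂μ) v := by
    intro v _
    rw [integral_bregmanDiv_aux μ φ U hUint hφU, integral_bregmanDiv_aux μ φ U hUint hφU]
    unfold bregmanDiv
    rw [sub_self, inner_zero_right]
    ring
  refine ⟨key, fun v hv => ?_, fun hs v hv hne => ?_⟩
  · rw [key v hv]
    linarith [bregmanDiv_nonneg_aux S φ hφconv _ v hmean hv (hφdiff v hv)]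
  · rw [key v hv]
    linarith [hs _ hmean v hv hne.symm]
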